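/- Let G be a connected simple undirected graph on n ≥ 3 vertices with m edges and maximum degree d₁, let μ₁ ≥ μ₂ ≥ … ≥ μ_n = 0 be the eigenvalues of its Laplacian matrix, and assume μ₁ ≥ 1 + d₁ (which holds for every graph with at least one edge). Then for every real α with α > 1 or α < 0, s_α(G) ≥ (1+d₁)^α + (n−2)^{1−α} (2m−1−d₁)^α, while for 0 < α < 1, s_α(G) ≤ (1+d₁)^α + (n−2)^{1−α} (2m−1−d₁)^α. -/

import Mathlib

lemma aux_core {ι : Type*} (T : Finset ι) (y : ι → ℝ) (φ g : ℝ → ℝ) (x a b : ℝ)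
    (htan : ∀ u v, 0 < u → 0 < v → φ u + g u * (v - u) ≤ φ v)
    (ha : 0 < a) (hb : 0 < b) (hba : b ≤ a) (hax : a ≤ x) (hy : ∀ i ∈ T, 0 < y i)
    (hsum : x + ∑ i ∈ T, y i = a + (T.card : ℝ) * b) :
    φ a + (T.card : ℝ) * φ b ≤ φ x + ∑ i ∈ T, φ (y i) := by
  have h1 := htan a x ha (ha.trans_le hax)
  have h2 : ∑ i ∈ T, (φ b + g b * (y i - b)) ≤ ∑ i ∈ T, φ (y i) :=
    Finset.sum_le_sum fun i hi => htan b (y i) hb (hy i hi)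
  rw [Finset.sum_add_distrib, ← Finset.mul_sum, Finset.sum_sub_distrib] at h2
  simp only [Finset.sum_const, nsmul_eq_mul] at h2
  have hg : g b ≤ g a := by
    rcases hba.eq_or_lt with h | h
    · rw [h]
    · have h3 := htan a b ha hb
      have h4 := htan b a hb ha
      by_contra hc
      push Not at hc
      nlinarith [mul_pos (sub_pos.2 hc) (sub_pos.2 h)]
  have h5 : ∑ i ∈ T, y i - (T.card : ℝ) * b = a - x := by linarith
  rw [h5] at h2
  nlinarith [mul_nonneg (sub_nonneg.2 hg) (sub_nonneg.2 hax)]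

lemma aux_bern (α t : ℝ) (h : 1 < α ∨ α < 0) (ht : 0 < t) : 1 + α * (t - 1) ≤ t ^ α := by
  rcases h with h | h
  · have := one_add_mul_self_le_rpow_one_add (s := t - 1) (by linarith) h.le
    simpa using this
  · have := one_add_mul_self_le_rpow_one_add (s := t⁻¹ - 1) (p := 1 - α)
      (by have := inv_pos.2 ht; linarith) (by linarith)
    rw [add_sub_cancel, Real.inv_rpow ht.le, ← Real.rpow_neg ht.le, neg_sub,
      Real.rpow_sub_one ht.ne', le_div_iff₀ ht] at this
    have e : (1 + (1 - α) * (t⁻¹ - 1)) * t = 1 + α * (t - 1) := by field_simp; ring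
    linarith

lemma aux_bern' (α t : ℝ) (h : 0 < α ∧ α < 1) (ht : 0 < t) : t ^ α ≤ 1 + α * (t - 1) := by
  have := rpow_one_add_le_one_add_mul_self (s := t - 1) (by linarith) h.1.le h.2.le
  simpa using this

lemma aux_scale (α u v : ℝ) (hu : 0 < u) (hv : 0 < v) : v ^ α = u ^ α * (v / u) ^ α := by
  rw [← Real.mul_rpow hu.le (by positivity), mul_div_cancel₀ _ hu.ne']

lemma aux_lin (α u v : ℝ) (hu : 0 < u) :
    u ^ α + (u ^ α * α / u) * (v - u) = u ^ α * (1 + α * (v / u - 1)) := by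
  field_simp

lemma aux_tan (α u v : ℝ) (h : 1 < α ∨ α < 0) (hu : 0 < u) (hv : 0 < v) :
    u ^ α + (u ^ α * α / u) * (v - u) ≤ v ^ α := by
  rw [aux_scale α u v hu hv, aux_lin _ _ _ hu]
  exact mul_le_mul_of_nonneg_left (aux_bern α _ h (by positivity)) (by positivity)

lemma aux_tan' (α u v : ℝ) (h : 0 < α ∧ α < 1) (hu : 0 < u) (hv : 0 < v) :
    v ^ α ≤ u ^ α + (u ^ α * α / u) * (v - u) := by
  rw [aux_scale α u v hu hv, aux_lin _ _ _ hu]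
  exact mul_le_mul_of_nonneg_left (aux_bern' α _ h (by positivity)) (by positivity)

lemma aux_k (α k s : ℝ) (hk : 0 < k) (hs : 0 < s) : k ^ (1 - α) * s ^ α = k * (s / k) ^ α := by
  rw [Real.div_rpow hs.le hk.le, Real.rpow_sub hk, Real.rpow_one]
  ring

lemma aux_spec {n : ℕ} (G : SimpleGraph (Fin n)) [DecidableRel G.Adj]
    (hconn : G.Connected) (μ : Fin n → ℝ)
    (hchar : (SimpleGraph.lapMatrix ℝ G).charpoly =
      ∏ i, (Polynomial.X - Polynomial.C (μ i))) :
    (∀ i, 0 ≤ μ i) ∧ ∑ i, μ i = 2 * (G.edgeFinset.card : ℝ) ∧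
      ∀ i j, μ i = 0 → μ j = 0 → i = j := by
  have hH : (G.lapMatrix ℝ).IsHermitian := SimpleGraph.isHermitian_lapMatrix ℝ G
  have hms : Finset.univ.val.map μ = Finset.univ.val.map hH.eigenvalues := by
    have h1 := hH.roots_charpoly_eq_eigenvalues
    rw [hchar, Polynomial.roots_prod _ _
      (by simp [Finset.prod_ne_zero_iff, Polynomial.X_sub_C_ne_zero])] at h1
    simpa [Function.comp_def] using h1
  have hnn := (SimpleGraph.posSemidef_lapMatrix ℝ G)
  refine ⟨?_, ?_, ?_⟩
  · intro i
    have : μ i ∈ Finset.univ.val.map μ := Multiset.mem_map_of_mem _ (Finset.mem_univ i)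
    rw [hms] at this
    obtain ⟨j, -, hj⟩ := Multiset.mem_map.1 this
    rw [← hj]
    exact Matrix.PosSemidef.eigenvalues_nonneg hnn j
  · have h1 : ∑ i, μ i = ∑ i, hH.eigenvalues i := by
      have := congrArg Multiset.sum hms
      exact this
    have h2 := hH.trace_eq_sum_eigenvalues
    have h3 : (G.lapMatrix ℝ).trace = ∑ v, (G.degree v : ℝ) := by
      simp [Matrix.trace, SimpleGraph.lapMatrix, SimpleGraph.degMatrix]
    rw [h1]
    have h4 := G.sum_degrees_eq_twice_card_edges
    have h5 : ∑ v, (G.degree v : ℝ) = 2 * (G.edgeFinset.card : ℝ) := by exact_mod_cast h4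
    rw [← h5, ← h3, h2]
    simp
  · have hr := hH.rank_eq_card_non_zero_eigs
    have hk := SimpleGraph.card_connectedComponent_eq_finrank_ker_toLin'_lapMatrix G
    have hc : Fintype.card G.ConnectedComponent = 1 := by
      have := hconn.preconnected.subsingleton_connectedComponent
      obtain ⟨v⟩ := hconn.nonempty
      exact Fintype.card_eq_one_iff.2 ⟨G.connectedComponentMk v, fun y => Subsingleton.elim _ _⟩
    rw [hc] at hk
    have hrn := LinearMap.finrank_range_add_finrank_ker (Matrix.toLin' (G.lapMatrix ℝ))
    rw [← hk] at hrn
    have hr2 : (G.lapMatrix ℝ).rank =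
      Module.finrank ℝ (LinearMap.range (Matrix.toLin' (G.lapMatrix ℝ))) := rfl
    rw [← hr2, hr] at hrn
    have hcount : (Finset.univ.filter (fun i => μ i = 0)).card
        = (Finset.univ.filter (fun i => hH.eigenvalues i = 0)).card := by
      have := congrArg (Multiset.count 0) hms
      rw [Multiset.count_map, Multiset.count_map] at this
      simpa [Finset.card_def, eq_comm] using this
    have hadd := Finset.card_filter_add_card_filter_not (s := (Finset.univ : Finset (Fin n))) (fun i => hH.eigenvalues i = 0)
    rw [Fintype.card_subtype] at hrn
    simp at hrn hadd
    have h1 : (Finset.univ.filter (fun i => μ i = 0)).card ≤ 1 := by omega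
    intro i j hi hj
    exact Finset.card_le_one.1 h1 i (by simpa using hi) j (by simpa using hj)

/-- For a connected graph `G` on `n ≥ 3` vertices with `m` edges, maximum degree `d₁`,
nonincreasing Laplacian eigenvalues `μ₁ ≥ … ≥ μ_n = 0` with `μ₁ ≥ 1 + d₁`, and
`s_α(G) = ∑_{i=1}^{n−1} μ_i^α`: if `α > 1` or `α < 0` then
`s_α(G) ≥ (1+d₁)^α + (n−2)^{1−α}(2m−1−d₁)^α`, while for `0 < α < 1` the inequality is
reversed. -/
theorem stmt_10 {n : ℕ} (hn : 3 ≤ n) (G : SimpleGraph (Fin n)) [DecidableRel G.Adj]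
    (hconn : G.Connected) (m : ℕ) (hm : m = G.edgeFinset.card)
    (d1 : ℕ) (hd1max : ∀ v, G.degree v ≤ d1) (hd1mem : ∃ v, G.degree v = d1)
    (μ : Fin n → ℝ) (hμa : Antitone μ)
    (hchar : (SimpleGraph.lapMatrix ℝ G).charpoly =
      ∏ i, (Polynomial.X - Polynomial.C (μ i)))
    (hμn : μ ⟨n - 1, by omega⟩ = 0)
    (hμ1 : (1 : ℝ) + d1 ≤ μ ⟨0, by omega⟩)
    (α : ℝ) :
    ((1 < α ∨ α < 0) →
      ((1 : ℝ) + d1) ^ α + ((n : ℝ) - 2) ^ (1 - α) * (2 * (m : ℝ) - 1 - d1) ^ α ≤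
        ∑ i ∈ Finset.univ.filter (fun i : Fin n => (i : ℕ) < n - 1), μ i ^ α) ∧
    ((0 < α ∧ α < 1) →
      ∑ i ∈ Finset.univ.filter (fun i : Fin n => (i : ℕ) < n - 1), μ i ^ α ≤
        ((1 : ℝ) + d1) ^ α + ((n : ℝ) - 2) ^ (1 - α) * (2 * (m : ℝ) - 1 - d1) ^ α) := by
  obtain ⟨hnn, hsum, huniq⟩ := aux_spec G hconn μ hchar
  rw [← hm] at hsum
  set z : Fin n := ⟨0, by omega⟩ with hz
  set l : Fin n := ⟨n - 1, by omega⟩ with hl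
  set F := Finset.univ.filter (fun i : Fin n => (i : ℕ) < n - 1) with hF
  have hpos : ∀ i ∈ F, 0 < μ i := by
    intro i hi
    refine lt_of_le_of_ne (hnn i) fun h => ?_
    have := huniq i l h.symm hμn
    simp [hF] at hi
    rw [this] at hi
    simp [hl] at hi
  have hFe : F = Finset.univ.erase l := by
    ext i
    simp only [hF, hl, Finset.mem_filter, Finset.mem_univ, true_and, Finset.mem_erase, and_true,
      ne_eq, Fin.ext_iff]
    have := i.2
    omega
  have hFsum : ∑ i ∈ F, μ i = 2 * (m : ℝ) := by
    rw [← hsum, hFe, ← Finset.add_sum_erase _ μ (Finset.mem_univ l), hμn, zero_add]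
  have hzF : z ∈ F := by simp [hF, hz]; omega
  set T := F.erase z with hT
  have hTc : (T.card : ℝ) = (n : ℝ) - 2 := by
    rw [hT, Finset.card_erase_of_mem hzF, hFe, Finset.card_erase_of_mem (Finset.mem_univ l)]
    rw [Finset.card_univ, Fintype.card_fin, Nat.sub_sub, Nat.cast_sub (by omega)]
    norm_num
  have hsplit : ∀ f : Fin n → ℝ, ∑ i ∈ F, f i = f z + ∑ i ∈ T, f i :=
    fun f => (Finset.add_sum_erase _ f hzF).symm
  have hTpos : ∀ i ∈ T, 0 < μ i := fun i hi => hpos i (Finset.mem_of_mem_erase hi)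
  have hn3 : (3 : ℝ) ≤ n := by exact_mod_cast hn
  have hkpos : (0 : ℝ) < (n : ℝ) - 2 := by linarith
  have hTne : T.Nonempty := by
    rw [← Finset.card_pos]
    have : (0 : ℝ) < T.card := by rw [hTc]; exact hkpos
    exact_mod_cast this
  have hTs : 0 < ∑ i ∈ T, μ i := Finset.sum_pos hTpos hTne
  have hs2 := hsplit μ
  rw [hFsum] at hs2
  have hspos : 0 < 2 * (m : ℝ) - 1 - d1 := by linarith
  have hmn : 2 * (m : ℝ) ≤ n * d1 := by
    have h4 := G.sum_degrees_eq_twice_card_edges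
    rw [← hm] at h4
    have : ∑ v, G.degree v ≤ ∑ _v : Fin n, d1 := Finset.sum_le_sum fun v _ => hd1max v
    simp only [Finset.sum_const, Finset.card_univ, Fintype.card_fin, smul_eq_mul] at this
    rw [h4] at this
    exact_mod_cast this
  have hdn : (d1 : ℝ) + 1 ≤ n := by
    obtain ⟨v, hv⟩ := hd1mem
    have := G.degree_lt_card_verts v
    rw [hv, Fintype.card_fin] at this
    exact_mod_cast this
  have hba : (2 * (m : ℝ) - 1 - d1) / ((n : ℝ) - 2) ≤ 1 + d1 := by
    rw [div_le_iff₀ hkpos]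
    nlinarith
  have hb : 0 < (2 * (m : ℝ) - 1 - d1) / ((n : ℝ) - 2) := div_pos hspos hkpos
  have heq : μ z + ∑ i ∈ T, μ i
      = (1 + d1) + (T.card : ℝ) * ((2 * (m : ℝ) - 1 - d1) / ((n : ℝ) - 2)) := by
    rw [hTc, mul_div_cancel₀ _ hkpos.ne']
    linarith
  rw [aux_k α _ _ hkpos hspos, hsplit, ← hTc]
  rw [← hTc] at hb hba heq
  refine ⟨fun h => ?_, fun h => ?_⟩
  · exact aux_core T μ (fun t => t ^ α) (fun u => u ^ α * α / u) _ _ _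
      (fun u v hu hv => aux_tan α u v h hu hv) (by positivity) hb hba hμ1 hTpos heq
  · have := aux_core T μ (fun t => -t ^ α) (fun u => -(u ^ α * α / u)) _ _ _
      (fun u v hu hv => by have := aux_tan' α u v h hu hv; linarith)
      (by positivity) hb hba hμ1 hTpos heq
    simp only [Finset.sum_neg_distrib] at this
    linarith
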